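/- For each n, let ℋ_n be the family of associative trees on n variables whose root has more than n^{1/8} non-leaf subtrees. Then the limiting ratio of this family satisfies μ_n(ℋ_n) = Θ(n^{1/8} · 2^{−n^{1/8}}) as n → ∞, i.e. there are constants 0 < c₁ ≤ c₂ and an integer N with c₁·n^{1/8}·2^{−n^{1/8}} ≤ μ_n(ℋ_n) ≤ c₂·n^{1/8}·2^{−n^{1/8}} for all n ≥ N. -/

import Mathlib

/-- An and/or tree skeleton: leaves carry a variable index and a polarity
(`true` = positive literal, `false` = negated literal); internal nodes carry
a connective (`true` = AND, `false` = OR) and a list of children. -/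
inductive AT (n : ℕ) : Type
  | leaf : Fin n → Bool → AT n
  | node : Bool → List (AT n) → AT n

namespace AT

/-- The connective at the root, if the root is an internal node. -/
def rootConn {n : ℕ} : AT n → Option Bool
  | .leaf _ _ => none
  | .node c _ => some c

/-- Whether a tree is a single leaf. -/
def isLeafB {n : ℕ} : AT n → Bool
  | .leaf _ _ => true
  | .node _ _ => false

/-- The children of the root. -/
def rootChildren {n : ℕ} : AT n → List (AT n)
  | .leaf _ _ => []
  | .node _ ts => ts

/-- Well-formedness: an associative tree is a plane tree in which each internal
node has at least two children, no internal node has the same connective as its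
parent (stratification), and leaves carry literals. -/
inductive WF {n : ℕ} : AT n → Prop
  | leaf (i : Fin n) (b : Bool) : WF (.leaf i b)
  | node (c : Bool) (ts : List (AT n)) :
      2 ≤ ts.length → (∀ t ∈ ts, WF t) → (∀ t ∈ ts, rootConn t ≠ some c) →
      WF (.node c ts)

mutual
/-- The size of a tree: its total number of nodes. -/
def size {n : ℕ} : AT n → ℕ
  | .leaf _ _ => 1
  | .node _ ts => 1 + sizeList ts
def sizeList {n : ℕ} : List (AT n) → ℕ
  | [] => 0
  | t :: ts => size t + sizeList ts
end

mutual
/-- The Boolean function computed by a tree. -/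
def eval {n : ℕ} : AT n → (Fin n → Bool) → Bool
  | .leaf i b, x => if b then x i else ! x i
  | .node c ts, x => evalList c ts x
def evalList {n : ℕ} : Bool → List (AT n) → (Fin n → Bool) → Bool
  | c, [], _ => c
  | c, t :: ts, x => if c then eval t x && evalList c ts x
                     else eval t x || evalList c ts x
end

end AT

open AT

/-- Number of associative trees of size `m` in a family `𝒯`. -/
noncomputable def countIn (n : ℕ) (𝒯 : Set (AT n)) (m : ℕ) : ℕ :=
  Nat.card {t : AT n // t ∈ 𝒯 ∧ WF t ∧ size t = m}

/-- `A n m` is the number of associative trees of size `m` on `n` variables. -/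
noncomputable def A (n m : ℕ) : ℕ := countIn n Set.univ m

/-- `Pmn n m f` is the proportion, among associative trees of size `m` on `n`
variables, of those computing the Boolean function `f`. -/
noncomputable def Pmn (n m : ℕ) (f : (Fin n → Bool) → Bool) : ℝ :=
  (countIn n {t | eval t = f} m : ℝ) / (A n m : ℝ)

/-- Ratio of trees of size `m` in the family `𝒯` among all trees of size `m`. -/
noncomputable def ratio (n : ℕ) (𝒯 : Set (AT n)) (m : ℕ) : ℝ :=
  (countIn n 𝒯 m : ℝ) / (A n m : ℝ)

/-- `HasLimRatio n 𝒯 μ` : the limiting ratio of the family `𝒯` exists and is `μ`. -/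
def HasLimRatio (n : ℕ) (𝒯 : Set (AT n)) (μ : ℝ) : Prop :=
  Filter.Tendsto (ratio n 𝒯) Filter.atTop (nhds μ)

/-- Extension of a Boolean function of `n₀` variables to `n ≥ n₀` variables. -/
def extend {n₀ n : ℕ} (h : n₀ ≤ n) (f : (Fin n₀ → Bool) → Bool) :
    (Fin n → Bool) → Bool :=
  fun x => f (fun j => x (Fin.castLE h j))

open Classical in
/-- The tree size complexity of a Boolean function. -/
noncomputable def Lcomp (n : ℕ) (f : (Fin n → Bool) → Bool) : ℕ :=
  if f = (fun _ => true) ∨ f = (fun _ => false) then 0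
  else if ∃ i : Fin n, f = (fun x => x i) ∨ f = (fun x => ! x i) then 2
  else sInf {m | ∃ t : AT n, WF t ∧ size t = m ∧ eval t = f}

/-- The family `ℋ_n` of associative trees whose root has more than `n^{1/8}`
non-leaf subtrees. -/
def Hfam (n : ℕ) : Set (AT n) :=
  {t | (n : ℝ) ^ ((1 : ℝ) / 8) <
        (((rootChildren t).filter (fun s => !isLeafB s)).length : ℝ)}

open PowerSeries Filter Topology in
/-- `v` has radius of convergence larger than `ρ`, and value `x` at `ρ`. -/
def Good (ρ : ℝ) (v : PowerSeries ℝ) (x : ℝ) : Prop :=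
  ∃ R, ρ < R ∧ Summable (fun m => |coeff m v| * R ^ m) ∧ HasSum (fun m => coeff m v * ρ ^ m) x

open PowerSeries Filter Topology in
/-- Coefficients of `f` are asymptotic to `c * u`. -/
def Asy (u : ℕ → ℝ) (f : PowerSeries ℝ) (c : ℝ) : Prop :=
  Tendsto (fun m => coeff m f / u m) atTop (𝓝 c)

section analytic
open PowerSeries Filter Topology

lemma wbound {u : ℕ → ℝ} {ρ R : ℝ} (hρ : 0 < ρ) (hu : ∀ m, 0 < u m)
    (hr : Tendsto (fun m => u m / u (m + 1)) atTop (𝓝 ρ)) (hR : ρ < R) :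
    ∃ C, 0 < C ∧ ∀ j m, j ≤ m → u j * R ^ j ≤ C * (u m * R ^ m) := by
  have hR0 : 0 < R := hρ.trans hR
  obtain ⟨J, hJ⟩ := eventually_atTop.1 (hr.eventually_lt_const hR)
  set w : ℕ → ℝ := fun j => u j * R ^ j with hw
  have wpos : ∀ j, 0 < w j := fun j => mul_pos (hu j) (pow_pos hR0 j)
  have hmono : ∀ j, J ≤ j → w j ≤ w (j + 1) := by
    intro j hj
    have h := hJ j hj
    rw [div_lt_iff₀ (hu _)] at h
    simp only [hw, pow_succ]
    have := pow_pos hR0 j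
    nlinarith
  have hmono2 : ∀ j m, J ≤ j → j ≤ m → w j ≤ w m := by
    intro j m hj hm
    induction m, hm using Nat.le_induction with
    | base => exact le_rfl
    | succ m hm ih => exact ih.trans (hmono m (hj.trans hm))
  set C : ℝ := 1 + ∑ i ∈ Finset.range (J+1), ∑ j ∈ Finset.range (J+1), w j / w i with hC
  have hnn : ∀ i j, 0 ≤ w j / w i := fun i j => (div_pos (wpos j) (wpos i)).le
  have hC1 : 1 ≤ C := by
    have : 0 ≤ ∑ i ∈ Finset.range (J+1), ∑ j ∈ Finset.range (J+1), w j / w i :=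
      Finset.sum_nonneg fun i _ => Finset.sum_nonneg fun j _ => hnn i j
    linarith
  have hC2 : ∀ i j, i ≤ J → j ≤ J → w j ≤ C * w i := by
    intro i j hi hj
    rw [← div_le_iff₀ (wpos i)]
    have h1 : w j / w i ≤ ∑ j ∈ Finset.range (J+1), w j / w i :=
      Finset.single_le_sum (f := fun j => w j / w i) (fun j _ => hnn i j)
        (Finset.mem_range.2 (by omega))
    have h2 : ∑ j ∈ Finset.range (J+1), w j / w i ≤
        ∑ i ∈ Finset.range (J+1), ∑ j ∈ Finset.range (J+1), w j / w i :=
      Finset.single_le_sum (f := fun i => ∑ j ∈ Finset.range (J+1), w j / w i)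
        (fun i _ => Finset.sum_nonneg fun j _ => hnn i j)
        (Finset.mem_range.2 (by omega))
    linarith
  refine ⟨C, by linarith, fun j m hjm => ?_⟩
  change w j ≤ C * w m
  have hCm : w m ≤ C * w m := by nlinarith [wpos m]
  rcases le_total J j with h | h
  · exact (hmono2 j m h hjm).trans hCm
  · rcases le_total m J with h' | h'
    · exact hC2 m j h' h
    · calc w j ≤ C * w J := hC2 J j le_rfl h
        _ ≤ C * w m := by
          have := hmono2 J m le_rfl h'
          nlinarith

lemma Good.zero_asy {u : ℕ → ℝ} {ρ x : ℝ} {v : PowerSeries ℝ} (hρ : 0 < ρ) (hu : ∀ m, 0 < u m)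
    (hr : Tendsto (fun m => u m / u (m + 1)) atTop (𝓝 ρ)) (hv : Good ρ v x) : Asy u v 0 := by
  obtain ⟨R, hR, hs, -⟩ := hv
  have hR0 : 0 < R := hρ.trans hR
  obtain ⟨C, hC, hw⟩ := wbound hρ hu hr hR
  have h0 := hs.tendsto_atTop_zero
  have h1 := h0.mul_const (C / u 0)
  rw [zero_mul] at h1
  refine squeeze_zero_norm (fun m => ?_) h1
  have h := hw 0 m (Nat.zero_le m)
  rw [pow_zero, mul_one] at h
  rw [Real.norm_eq_abs, abs_div, abs_of_pos (hu m), mul_assoc]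
  rw [div_eq_mul_inv]
  refine mul_le_mul_of_nonneg_left ?_ (abs_nonneg _)
  rw [inv_le_iff_one_le_mul₀ (hu m)]
  have : R ^ m * (C / u 0) * u m = C * (u m * R ^ m) / u 0 := by ring
  rw [this, le_div_iff₀ (hu 0)]
  linarith

lemma ratio_shift {u : ℕ → ℝ} {ρ : ℝ} (hu : ∀ m, 0 < u m)
    (hr : Tendsto (fun m => u m / u (m + 1)) atTop (𝓝 ρ)) (i : ℕ) :
    Tendsto (fun m => u m / u (m + i)) atTop (𝓝 (ρ ^ i)) := by
  induction i with
  | zero =>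
    simp only [add_zero, pow_zero]
    refine tendsto_const_nhds.congr fun m => ?_
    rw [div_self (hu m).ne']
  | succ i ih =>
    have h2 := (tendsto_add_atTop_iff_nat i).2 hr
    have := ih.mul h2
    rw [pow_succ]
    refine this.congr fun m => ?_
    have h1 := (hu (m+i)).ne'
    have h2 := (hu (m+i+1)).ne'
    rw [← add_assoc]
    field_simp

lemma Asy.mul_good {u : ℕ → ℝ} {ρ x c : ℝ} {v f : PowerSeries ℝ} (hρ : 0 < ρ)
    (hu : ∀ m, 0 < u m)
    (hr : Tendsto (fun m => u m / u (m + 1)) atTop (𝓝 ρ)) (hv : Good ρ v x) (hf : Asy u f c) :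
    Asy u (v * f) (x * c) := by
  obtain ⟨R, hR, hs, hx⟩ := hv
  have hR0 : 0 < R := hρ.trans hR
  obtain ⟨C, hC, hw⟩ := wbound hρ hu hr hR
  obtain ⟨D, hD⟩ := (Filter.Tendsto.bddAbove_range hf.abs)
  have hD' : ∀ m, |coeff m f| ≤ D * u m := by
    intro m
    have := hD ⟨m, rfl⟩
    simp only [abs_div, abs_of_pos (hu m)] at this
    rwa [div_le_iff₀ (hu m)] at this
  have hD0 : 0 ≤ D := by
    have h1 := hD' 0
    have h2 := abs_nonneg (coeff 0 f)
    by_contra h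
    push Not at h
    nlinarith [hu 0]
  have key := tendsto_tsum_of_dominated_convergence (𝓕 := atTop)
    (f := fun m i => if i ≤ m then coeff i v * (coeff (m - i) f / u m) else 0)
    (g := fun i => coeff i v * ρ ^ i * c)
    (bound := fun i => (|coeff i v| * R ^ i) * (D * C)) (hs.mul_right _) ?_ ?_
  · have hlim : ∑' i, coeff i v * ρ ^ i * c = x * c := (hx.mul_right c).tsum_eq
    rw [hlim] at key
    refine key.congr fun m => ?_
    rw [tsum_eq_sum (s := Finset.range (m+1))]
    · rw [PowerSeries.coeff_mul, Finset.Nat.sum_antidiagonal_eq_sum_range_succ_mk, Finset.sum_div]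
      refine Finset.sum_congr rfl fun i hi => ?_
      rw [if_pos (by simpa [Nat.lt_succ_iff] using hi), mul_div_assoc]
    · intro i hi
      rw [if_neg]
      simpa [Nat.lt_succ_iff] using hi
  · intro i
    rw [← tendsto_add_atTop_iff_nat i]
    have h1 := ((ratio_shift hu hr i).mul hf).const_mul (coeff i v)
    rw [← mul_assoc] at h1
    refine h1.congr fun m => ?_
    rw [if_pos (by omega), Nat.add_sub_cancel]
    have := (hu m).ne'
    field_simp
  · refine Eventually.of_forall fun m i => ?_
    split_ifs with h
    · rw [Real.norm_eq_abs, abs_mul, mul_assoc]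
      refine mul_le_mul_of_nonneg_left ?_ (abs_nonneg _)
      rw [abs_div, abs_of_pos (hu m), div_le_iff₀ (hu m)]
      have h1 := hw (m - i) m (Nat.sub_le _ _)
      have h2 : u (m - i) ≤ R ^ i * C * u m := by
        have h3 : R ^ m = R ^ i * R ^ (m - i) := by rw [← pow_add]; congr 1; omega
        rw [h3] at h1
        have h4 := pow_pos hR0 (m - i)
        refine le_of_mul_le_mul_right ?_ h4
        linarith
      calc |coeff (m - i) f| ≤ D * u (m - i) := hD' _
        _ ≤ D * (R ^ i * C * u m) := mul_le_mul_of_nonneg_left h2 hD0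
        _ = _ := by ring
    · rw [norm_zero]; positivity

lemma Asy.add {u : ℕ → ℝ} {f g : PowerSeries ℝ} {c d : ℝ} (hf : Asy u f c) (hg : Asy u g d) :
    Asy u (f + g) (c + d) := by
  refine (Filter.Tendsto.add hf hg).congr fun m => ?_
  rw [map_add, add_div]

lemma Asy.neg {u : ℕ → ℝ} {f : PowerSeries ℝ} {c : ℝ} (hf : Asy u f c) :
    Asy u (-f) (-c) := by
  refine (Filter.Tendsto.neg hf).congr fun m => ?_
  rw [map_neg, neg_div]

lemma Asy.sub {u : ℕ → ℝ} {f g : PowerSeries ℝ} {c d : ℝ} (hf : Asy u f c) (hg : Asy u g d) :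
    Asy u (f - g) (c - d) := by
  rw [sub_eq_add_neg, sub_eq_add_neg]; exact hf.add hg.neg

lemma Good.shrink {R R' : ℝ} {v : PowerSeries ℝ} (h0 : 0 ≤ R') (h : R' ≤ R)
    (hs : Summable (fun m => |coeff m v| * R ^ m)) :
    Summable (fun m => |coeff m v| * R' ^ m) := by
  refine Summable.of_nonneg_of_le (fun m => by positivity) (fun m => ?_) hs
  gcongr

lemma Good.add {ρ x y : ℝ} {v w : PowerSeries ℝ} (hρ : 0 < ρ) (hv : Good ρ v x) (hw : Good ρ w y) :
    Good ρ (v + w) (x + y) := by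
  obtain ⟨R, hR, hs, hx⟩ := hv
  obtain ⟨R', hR', hs', hx'⟩ := hw
  have hm : ρ < min R R' := lt_min hR hR'
  have hm0 := (hρ.trans hm).le
  refine ⟨min R R', hm, ?_, ?_⟩
  · refine Summable.of_nonneg_of_le (fun m => by positivity) (fun m => ?_)
      ((Good.shrink hm0 (min_le_left _ _) hs).add
        (Good.shrink hm0 (min_le_right _ _) hs'))
    rw [← add_mul, map_add]
    exact mul_le_mul_of_nonneg_right (abs_add_le _ _) (by positivity)
  · simpa [add_mul] using hx.add hx'

lemma Good.neg {ρ x : ℝ} {v : PowerSeries ℝ} (hv : Good ρ v x) : Good ρ (-v) (-x) := by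
  obtain ⟨R, hR, hs, hx⟩ := hv
  exact ⟨R, hR, by simpa using hs, by simpa using hx.neg⟩

lemma Good.sub {ρ x y : ℝ} {v w : PowerSeries ℝ} (hρ : 0 < ρ) (hv : Good ρ v x) (hw : Good ρ w y) :
    Good ρ (v - w) (x - y) := by
  rw [sub_eq_add_neg, sub_eq_add_neg]; exact hv.add hρ hw.neg

lemma Good.mul {ρ x y : ℝ} {v w : PowerSeries ℝ} (hρ : 0 < ρ) (hv : Good ρ v x) (hw : Good ρ w y) :
    Good ρ (v * w) (x * y) := by
  obtain ⟨R, hR, hs, hx⟩ := hv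
  obtain ⟨R', hR', hs', hx'⟩ := hw
  have hm : ρ < min R R' := lt_min hR hR'
  have hm0 := (hρ.trans hm).le
  have cf : ∀ (t : ℝ) (m : ℕ), coeff m (v * w) * t ^ m =
      ∑ kl ∈ Finset.HasAntidiagonal.antidiagonal m, (coeff kl.1 v * t ^ kl.1) * (coeff kl.2 w * t ^ kl.2) := by
    intro t m
    rw [PowerSeries.coeff_mul, Finset.sum_mul]
    refine Finset.sum_congr rfl fun kl hkl => ?_
    rw [← Finset.HasAntidiagonal.mem_antidiagonal.1 hkl, pow_add]; ring
  have S1 : ∀ t, 0 ≤ t → t ≤ min R R' → Summable (fun m => ‖coeff m v * t ^ m‖) := by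
    intro t ht htm
    have := Good.shrink ht (htm.trans (min_le_left _ _)) hs
    simpa [abs_mul, abs_of_nonneg ht] using this
  have S2 : ∀ t, 0 ≤ t → t ≤ min R R' → Summable (fun m => ‖coeff m w * t ^ m‖) := by
    intro t ht htm
    have := Good.shrink ht (htm.trans (min_le_right _ _)) hs'
    simpa [abs_mul, abs_of_nonneg ht] using this
  have S3 : ∀ t, 0 ≤ t → t ≤ min R R' → Summable (fun m => ‖coeff m (v * w) * t ^ m‖) := by
    intro t ht htm
    have := summable_norm_sum_mul_antidiagonal_of_summable_norm (S1 t ht htm) (S2 t ht htm)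
    simpa only [cf] using this
  refine ⟨min R R', hm, ?_, ?_⟩
  · have := S3 _ hm0 le_rfl
    simpa [abs_mul, abs_of_nonneg hm0] using this
  · have h1 := tsum_mul_tsum_eq_tsum_sum_antidiagonal_of_summable_norm
      (S1 ρ hρ.le hm.le) (S2 ρ hρ.le hm.le)
    rw [hx.tsum_eq, hx'.tsum_eq] at h1
    simp only [← cf] at h1
    rw [h1]
    exact (S3 ρ hρ.le hm.le).of_norm.hasSum

lemma Good.C {ρ : ℝ} (k : ℝ) : Good ρ (PowerSeries.C k) k := by
  refine ⟨ρ + 1, by linarith, ?_, ?_⟩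
  · refine summable_of_ne_finset_zero (s := {0}) fun m hm => ?_
    simp at hm
    simp [PowerSeries.coeff_C, hm]
  · convert hasSum_single (f := fun m => coeff m (PowerSeries.C k) * ρ ^ m) 0 (fun m hm => ?_) using 1
    · simp
    · simp [PowerSeries.coeff_C, hm]

lemma Good.one {ρ : ℝ} : Good ρ 1 1 := by
  have := Good.C (ρ := ρ) 1
  simpa using this

lemma Good.X {ρ : ℝ} : Good ρ PowerSeries.X ρ := by
  refine ⟨ρ + 1, by linarith, ?_, ?_⟩
  · refine summable_of_ne_finset_zero (s := {1}) fun m hm => ?_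
    simp at hm
    simp [PowerSeries.coeff_X, hm]
  · convert hasSum_single (f := fun m => coeff m (PowerSeries.X : PowerSeries ℝ) * ρ ^ m) 1 (fun m hm => ?_) using 1
    · simp
    · simp [PowerSeries.coeff_X, hm]

/-- geometric series -/
noncomputable def geo (c : ℝ) : PowerSeries ℝ := PowerSeries.mk fun m => c ^ m

lemma geo_mul (c : ℝ) : geo c * (1 - PowerSeries.C c * PowerSeries.X) = 1 := by
  ext m
  rw [mul_sub, mul_one, ← mul_assoc, map_sub]
  cases m with
  | zero => simp [geo]
  | succ m =>
    rw [PowerSeries.coeff_succ_mul_X, mul_comm (geo c), PowerSeries.coeff_C_mul]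
    simp [geo, PowerSeries.coeff_one, pow_succ]
    ring

lemma exists_R {ρ c : ℝ} (h : |c| * ρ < 1) : ∃ R, ρ < R ∧ |c| * R < 1 := by
  by_cases hc : |c| = 0
  · exact ⟨ρ + 1, by linarith, by rw [hc]; norm_num⟩
  have hc' : 0 < |c| := lt_of_le_of_ne (abs_nonneg _) (Ne.symm hc)
  have : ρ < 1 / |c| := by rw [lt_div_iff₀ hc']; linarith
  obtain ⟨R, h1, h2⟩ := exists_between this
  refine ⟨R, h1, ?_⟩
  rw [lt_div_iff₀ hc'] at h2; linarith

lemma Good.of_bound {ρ c : ℝ} {v : PowerSeries ℝ} (hρ : 0 < ρ) (h : |c| * ρ < 1)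
    (hb : ∀ m, |coeff m v| ≤ |c| ^ m) : ∃ x, Good ρ v x := by
  obtain ⟨R, h1, h2⟩ := exists_R h
  have hR0 := (hρ.trans h1)
  have hs : Summable (fun m => |coeff m v| * R ^ m) := by
    refine Summable.of_nonneg_of_le (fun m => by positivity) (fun m => ?_)
      (summable_geometric_of_lt_one (r := |c| * R) (by positivity) h2)
    rw [mul_pow]
    exact mul_le_mul_of_nonneg_right (hb m) (by positivity)
  have hs' := Good.shrink hρ.le h1.le hs
  refine ⟨_, R, h1, hs, Summable.hasSum (Summable.of_norm ?_)⟩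
  simpa [abs_mul, abs_of_pos hρ] using hs'

lemma Good.unique {ρ x y : ℝ} {v : PowerSeries ℝ} (h : Good ρ v x) (h' : Good ρ v y) : x = y := by
  obtain ⟨R, hR, hs, hx⟩ := h
  obtain ⟨R', hR', hs', hx'⟩ := h'
  exact hx.unique hx'

lemma Good.geo {ρ c : ℝ} (hρ : 0 < ρ) (h : |c| * ρ < 1) : Good ρ (geo c) (1 - c * ρ)⁻¹ := by
  obtain ⟨x, hx⟩ := Good.of_bound (v := _root_.geo c) hρ h (by simp [_root_.geo])
  have h1 := hx.mul hρ ((Good.one).sub hρ ((Good.C c).mul hρ Good.X))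
  rw [geo_mul] at h1
  have h2 := h1.unique Good.one
  rw [← eq_inv_of_mul_eq_one_left h2]
  exact hx

/-- The rescaled Catalan series. -/
noncomputable def catS (a : ℝ) : PowerSeries ℝ := PowerSeries.mk fun m => catalan m * (a / 4) ^ m

lemma catS_eq (a : ℝ) :
    catS a = 1 + PowerSeries.C (a / 4) * PowerSeries.X * catS a ^ 2 := by
  have h := congrArg (fun f => PowerSeries.rescale (a/4) (PowerSeries.map (Nat.castRingHom ℝ) f))
    PowerSeries.catalanSeries_sq_mul_X_add_one
  simp only [map_add, map_mul, map_pow, map_one, PowerSeries.map_X, PowerSeries.rescale_X] at h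
  have h2 : PowerSeries.rescale (a/4) (PowerSeries.map (Nat.castRingHom ℝ) PowerSeries.catalanSeries)
      = catS a := by
    ext m
    simp [catS, PowerSeries.coeff_rescale, mul_comm]
  rw [h2] at h
  rw [← h]
  rw [h]
  linear_combination (-1 : PowerSeries ℝ) * h

/-- sqrt(1 - a X) -/
noncomputable def sqS (a : ℝ) : PowerSeries ℝ :=
  1 - PowerSeries.C (a / 2) * (PowerSeries.X * catS a)

lemma sqS_sq (a : ℝ) : sqS a ^ 2 = 1 - PowerSeries.C a * PowerSeries.X := by
  have h := catS_eq a
  have h1 : PowerSeries.C a = 4 * PowerSeries.C (a/4) := by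
    rw [← map_ofNat (PowerSeries.C (R := ℝ)) 4, ← map_mul]; congr 1; ring
  have h2 : PowerSeries.C (a/2) = 2 * PowerSeries.C (a/4) := by
    rw [← map_ofNat (PowerSeries.C (R := ℝ)) 2, ← map_mul]; congr 1; ring
  rw [sqS, h1, h2]
  linear_combination (-4 * PowerSeries.C (a/4) * PowerSeries.X) * h

lemma catalan_pos' (m : ℕ) : 0 < catalan m := by
  have := succ_mul_catalan_eq_centralBinom m
  have h2 := Nat.centralBinom_pos m
  rw [← this] at h2
  exact Nat.pos_of_mul_pos_left h2

lemma catalan_succ_ratio (m : ℕ) : ((m : ℝ) + 2) * catalan (m + 1) = 2 * (2 * m + 1) * catalan m := by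
  have h1 := succ_mul_catalan_eq_centralBinom m
  have h2 := succ_mul_catalan_eq_centralBinom (m + 1)
  have h3 := Nat.succ_mul_centralBinom_succ m
  rw [← h1, ← h2] at h3
  have h4 : ((m + 1) * ((m + 1 + 1) * catalan (m + 1)) : ℝ) =
    2 * (2 * m + 1) * ((m + 1) * catalan m) := by exact_mod_cast h3
  have : ((m : ℝ) + 1) ≠ 0 := by positivity
  apply mul_left_cancel₀ this
  linear_combination h4

lemma catalan_le (m : ℕ) : (catalan m : ℝ) ≤ 4 ^ m := by
  induction m with
  | zero => simp
  | succ m ih =>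
    have h := catalan_succ_ratio m
    have hp : (0:ℝ) < (m : ℝ) + 2 := by positivity
    have h0 : (0:ℝ) ≤ catalan m := by positivity
    rw [pow_succ]
    refine le_of_mul_le_mul_left ?_ hp
    rw [h]
    nlinarith

lemma catalan_ratio_tendsto {a : ℝ} (ha : 0 < a) :
    Tendsto (fun m : ℕ => ((catalan m : ℝ) * (a/4)^m) / (catalan (m+1) * (a/4)^(m+1))) atTop
      (𝓝 (1 / a)) := by
  have h1 : Tendsto (fun m : ℕ => (1 / a) * (1 + (3/2) * (1 / ((m : ℝ) + 1/2)))) atTop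
      (𝓝 ((1 / a) * (1 + (3/2) * 0))) := by
    refine Tendsto.const_mul _ (Tendsto.const_add _ (Tendsto.const_mul _ ?_))
    simp only [one_div]
    exact tendsto_inv_atTop_zero.comp
      (tendsto_atTop_add_const_right _ _ tendsto_natCast_atTop_atTop)
  simp only [mul_zero, add_zero, mul_one] at h1
  refine h1.congr fun m => ?_
  have h := catalan_succ_ratio m
  have p1 : (0:ℝ) < catalan m := by exact_mod_cast catalan_pos' m
  have p2 : (0:ℝ) < catalan (m+1) := by exact_mod_cast catalan_pos' (m+1)
  have p3 : (0:ℝ) < (a/4)^m := by positivity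
  have p4 : (0:ℝ) < (m:ℝ) + 1/2 := by positivity
  rw [eq_div_iff (by positivity), pow_succ]
  field_simp
  linear_combination 2 * h

lemma Good.sqS {ρ c : ℝ} (hρ : 0 < ρ) (h : |c| * ρ < 1) : ∃ x, x ≠ 0 ∧ Good ρ (_root_.sqS c) x := by
  obtain ⟨x, hx⟩ := Good.of_bound (v := catS c) hρ h (by
    intro m
    simp only [catS, PowerSeries.coeff_mk, abs_mul, abs_pow, abs_div, Nat.abs_cast]
    have h4 : |(4:ℝ)| = 4 := by norm_num
    rw [h4, div_pow, mul_div_assoc', div_le_iff₀ (by positivity), mul_comm]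
    exact mul_le_mul_of_nonneg_left (catalan_le m) (by positivity))
  have h1 := (Good.one).sub hρ ((Good.C (c/2)).mul hρ ((Good.X).mul hρ hx))
  refine ⟨_, ?_, h1⟩
  intro h0
  have h2 := (h1.mul hρ h1)
  have h3 := sqS_sq c
  rw [pow_two, _root_.sqS] at h3
  rw [h3] at h2
  have h4 := h2.unique ((Good.one).sub hρ ((Good.C c).mul hρ Good.X))
  rw [h0] at h4
  have h5 : c * ρ ≤ |c| * ρ := mul_le_mul_of_nonneg_right (le_abs_self c) hρ.le
  linarith

end analytic

section gf
open PowerSeries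

/-- Generating function of a set with respect to a size. -/
noncomputable def gf {α : Type*} (sz : α → ℕ) (S : Set α) : PowerSeries ℝ :=
  PowerSeries.mk fun m => ((S ∩ {x | sz x = m}).ncard : ℝ)

lemma gf_union {α : Type*} {sz : α → ℕ} (hfin : ∀ m, {x | sz x = m}.Finite) {S T : Set α}
    (h : Disjoint S T) : gf sz (S ∪ T) = gf sz S + gf sz T := by
  ext m
  simp only [gf, coeff_mk, map_add]
  rw [Set.union_inter_distrib_right, Set.ncard_union_eq
    (h.mono Set.inter_subset_left Set.inter_subset_left)
    ((hfin m).subset Set.inter_subset_right) ((hfin m).subset Set.inter_subset_right)]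
  push_cast; rfl

lemma gf_image {α β : Type*} {sz : α → ℕ} {sz' : β → ℕ} (f : α → β) (hf : Function.Injective f)
    (k : ℕ) (h : ∀ x, sz' (f x) = sz x + k) (S : Set α) :
    gf sz' (f '' S) = X ^ k * gf sz S := by
  ext m
  rw [coeff_X_pow_mul']
  simp only [gf, coeff_mk]
  split_ifs with hk
  · have : f '' S ∩ {x | sz' x = m} = f '' (S ∩ {x | sz x = m - k}) := by
      ext y
      constructor
      · rintro ⟨⟨x, hx, rfl⟩, hy⟩
        refine ⟨x, ⟨hx, ?_⟩, rfl⟩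
        simp only [Set.mem_ofPred_eq, h] at hy ⊢
        omega
      · rintro ⟨x, ⟨hx, hy⟩, rfl⟩
        refine ⟨⟨x, hx, rfl⟩, ?_⟩
        simp only [Set.mem_ofPred_eq, h] at hy ⊢
        omega
    rw [this, Set.ncard_image_of_injective _ hf]
  · have : f '' S ∩ {x | sz' x = m} = ∅ := by
      ext y
      simp only [Set.mem_inter_iff, Set.mem_image, Set.mem_ofPred_eq, Set.mem_empty_iff_false,
        iff_false]
      rintro ⟨⟨x, hx, rfl⟩, hy⟩
      rw [h] at hy
      omega
    rw [this]; simp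

lemma ncard_biUnion' {α ι : Type*} (s : Finset ι) (F : ι → Set α) (hfin : ∀ i ∈ s, (F i).Finite)
    (hd : ∀ i ∈ s, ∀ j ∈ s, i ≠ j → Disjoint (F i) (F j)) :
    (⋃ i ∈ s, F i).ncard = ∑ i ∈ s, (F i).ncard := by
  classical
  induction s using Finset.induction_on with
  | empty => simp
  | insert a s ha ih =>
    have f1 : (⋃ i ∈ s, F i).Finite :=
      Set.Finite.biUnion s.finite_toSet fun i hi => hfin i (Finset.mem_insert_of_mem hi)
    rw [Finset.set_biUnion_insert, Finset.sum_insert ha,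
      Set.ncard_union_eq ?_ (hfin a (Finset.mem_insert_self _ _)) f1, ih]
    · exact fun i hi => hfin i (Finset.mem_insert_of_mem hi)
    · exact fun i hi j hj => hd i (Finset.mem_insert_of_mem hi) j (Finset.mem_insert_of_mem hj)
    · rw [Set.disjoint_iUnion₂_right]
      intro i hi
      exact hd a (Finset.mem_insert_self _ _) i (Finset.mem_insert_of_mem hi)
        (fun h => ha (h ▸ hi))

lemma gf_image2 {α β γ : Type*} {sz : α → ℕ} {sz' : β → ℕ} {sz'' : γ → ℕ}
    (hfin : ∀ m, {x | sz'' x = m}.Finite) (f : α → β → γ) (hf : Function.Injective2 f)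
    (h : ∀ x y, sz'' (f x y) = sz x + sz' y) (S : Set α) (T : Set β) :
    gf sz'' (Set.image2 f S T) = gf sz S * gf sz' T := by
  ext m
  rw [coeff_mul]
  simp only [gf, coeff_mk]
  have e : Set.image2 f S T ∩ {x | sz'' x = m} =
      ⋃ p ∈ Finset.HasAntidiagonal.antidiagonal m,
        (Function.uncurry f) '' ((S ∩ {x | sz x = p.1}) ×ˢ (T ∩ {x | sz' x = p.2})) := by
    ext z
    simp only [Set.mem_inter_iff, Set.mem_image2, Set.mem_ofPred_eq, Set.mem_iUnion, Set.mem_image,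
      Set.mem_prod, Prod.exists, Function.uncurry_apply_pair, exists_prop,
      Finset.HasAntidiagonal.mem_antidiagonal]
    constructor
    · rintro ⟨⟨x, hx, y, hy, rfl⟩, hz⟩
      rw [h] at hz
      exact ⟨sz x, sz' y, hz, x, y, ⟨⟨hx, rfl⟩, hy, rfl⟩, rfl⟩
    · rintro ⟨i, j, hij, x, y, ⟨⟨hx, rfl⟩, hy, rfl⟩, rfl⟩
      exact ⟨⟨x, hx, y, hy, rfl⟩, by rw [h, hij]⟩
  rw [e, ncard_biUnion']
  · push_cast
    refine Finset.sum_congr rfl fun p _ => ?_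
    rw [Set.ncard_image_of_injective _ hf.uncurry, Set.ncard_prod]
    push_cast; rfl
  · intro p hp
    refine (hfin m).subset ?_
    have := Set.subset_biUnion_of_mem (u := fun p : ℕ × ℕ =>
      (Function.uncurry f) '' ((S ∩ {x | sz x = p.1}) ×ˢ (T ∩ {x | sz' x = p.2})))
      (s := {p | p ∈ Finset.HasAntidiagonal.antidiagonal m}) hp
    refine this.trans ?_
    refine Set.Subset.trans (Eq.subset e.symm) Set.inter_subset_right
  · intro p _ q _ hpq
    rw [Set.disjoint_left]
    rintro z ⟨⟨x, y⟩, ⟨⟨_, hx⟩, _, hy⟩, rfl⟩ ⟨⟨x', y'⟩, ⟨⟨_, hx'⟩, _, hy'⟩, he⟩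
    have := hf.uncurry he
    simp only [Prod.mk.injEq] at this
    obtain ⟨rfl, rfl⟩ := this
    simp only [Set.mem_ofPred_eq] at hx hy hx' hy'
    exact hpq (Prod.ext (hx ▸ hx'.symm ▸ rfl) (hy ▸ hy'.symm ▸ rfl))

end gf

section comb
open PowerSeries
variable {n : ℕ}

lemma size_pos' (t : AT n) : 1 ≤ size t := by
  cases t <;> simp [size]

lemma fin_aux (n m : ℕ) : {t : AT n | size t ≤ m}.Finite ∧ {l : List (AT n) | sizeList l ≤ m}.Finite := by
  induction m with
  | zero =>
    constructor
    · convert Set.finite_empty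
      ext t
      have := size_pos' t
      simp only [Set.mem_ofPred_eq, Set.mem_empty_iff_false, iff_false]
      omega
    · refine (Set.finite_singleton ([] : List (AT n))).subset ?_
      intro l hl
      cases l with
      | nil => rfl
      | cons t l =>
        have := size_pos' t
        simp only [Set.mem_ofPred_eq, sizeList] at hl
        omega
  | succ m ih =>
    have h1 : {t : AT n | size t ≤ m + 1}.Finite := by
      refine ((Set.finite_range (fun p : Fin n × Bool => AT.leaf p.1 p.2)).union
        (Set.Finite.image2 AT.node (Set.finite_univ) ih.2)).subset ?_
      intro t ht
      cases t with
      | leaf i b => exact Or.inl ⟨(i, b), rfl⟩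
      | node c l =>
        refine Or.inr ⟨c, Set.mem_univ _, l, ?_, rfl⟩
        simp only [Set.mem_ofPred_eq, size] at ht ⊢
        omega
    refine ⟨h1, ?_⟩
    refine ((Set.finite_singleton ([] : List (AT n))).union
      (Set.Finite.image2 List.cons h1 ih.2)).subset ?_
    intro l hl
    cases l with
    | nil => exact Or.inl rfl
    | cons t l =>
      refine Or.inr ⟨t, ?_, l, ?_, rfl⟩ <;>
      · have := size_pos' t
        simp only [Set.mem_ofPred_eq, sizeList] at hl ⊢
        omega

lemma finT (m : ℕ) : {t : AT n | size t = m}.Finite :=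
  (fin_aux n m).1.subset fun _ h => le_of_eq h

lemma finL (m : ℕ) : {t : List (AT n) | sizeList t = m}.Finite :=
  (fin_aux n m).2.subset fun _ h => le_of_eq h

def Lf (n : ℕ) : Set (AT n) := Set.range fun p : Fin n × Bool => AT.leaf p.1 p.2
def Wf (n : ℕ) (c : Bool) : Set (AT n) := {t | WF t ∧ rootConn t ≠ some c}
def Nd (n : ℕ) (c : Bool) : Set (AT n) := {t | WF t ∧ rootConn t = some c}
def nl {n : ℕ} (l : List (AT n)) : ℕ := (l.filter (fun s => !isLeafB s)).length
def Ls (n : ℕ) (c : Bool) (k : ℕ) : Set (List (AT n)) := {l | (∀ t ∈ l, t ∈ Wf n c) ∧ k ≤ nl l}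
def L2 (n : ℕ) (c : Bool) : Set (List (AT n)) := {l | (∀ t ∈ l, t ∈ Wf n c) ∧ 2 ≤ l.length}

lemma Lf_nl {t : AT n} (h : t ∈ Lf n) (l : List (AT n)) : nl (t :: l) = nl l := by
  obtain ⟨p, rfl⟩ := h
  simp [nl, isLeafB]

lemma Nd_nl {c : Bool} {t : AT n} (h : t ∈ Nd n c) (l : List (AT n)) : nl (t :: l) = nl l + 1 := by
  cases t with
  | leaf i b => simp [Nd, rootConn] at h
  | node c' ts => simp [nl, isLeafB]

lemma Lf_Nd (c : Bool) : Disjoint (Lf n) (Nd n c) := by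
  rw [Set.disjoint_left]
  rintro t ⟨p, rfl⟩ ⟨_, h⟩
  simp [rootConn] at h

lemma Nd_Nd : Disjoint (Nd n true) (Nd n false) := by
  rw [Set.disjoint_left]
  rintro t ⟨_, h⟩ ⟨_, h'⟩
  rw [h] at h'
  simp at h'

lemma Wf_eq (c : Bool) : Wf n c = Lf n ∪ Nd n (!c) := by
  ext t
  cases t with
  | leaf i b =>
    simp only [Wf, Lf, Nd, rootConn, Set.mem_union, Set.mem_ofPred_eq, Set.mem_range]
    exact ⟨fun _ => Or.inl ⟨(i, b), rfl⟩, fun _ => ⟨WF.leaf i b, by simp⟩⟩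
  | node c' ts =>
    simp only [Wf, Lf, Nd, rootConn, Set.mem_union, Set.mem_ofPred_eq, Set.mem_range]
    cases c <;> cases c' <;> simp

lemma all_eq : {t : AT n | WF t} = Lf n ∪ (Nd n true ∪ Nd n false) := by
  ext t
  cases t with
  | leaf i b =>
    simp only [Lf, Nd, rootConn, Set.mem_union, Set.mem_ofPred_eq, Set.mem_range]
    exact ⟨fun _ => Or.inl ⟨(i, b), rfl⟩, fun _ => WF.leaf i b⟩
  | node c' ts =>
    simp only [Lf, Nd, rootConn, Set.mem_union, Set.mem_ofPred_eq, Set.mem_range]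
    cases c' <;> simp

lemma cons_inj2 : Function.Injective2 (List.cons : AT n → List (AT n) → List (AT n)) := by
  intro a b c d h
  simpa using h

lemma gf_Lf : gf size (Lf n) = PowerSeries.C (2 * n : ℝ) * X := by
  ext m
  simp only [gf, coeff_mk, coeff_C_mul, coeff_X]
  split_ifs with h
  · subst h
    have : Lf n ∩ {x | size x = 1} = Lf n := by
      rw [Set.inter_eq_left]
      rintro t ⟨p, rfl⟩
      simp [size]
    rw [this, Lf, Set.ncard_range_of_injective]
    · rw [Nat.card_prod]; simp [mul_comm]
    · rintro ⟨a, b⟩ ⟨c, d⟩ h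
      simpa using h
  · have : Lf n ∩ {x | size x = m} = ∅ := by
      ext t
      simp only [Set.mem_inter_iff, Set.mem_ofPred_eq, Set.mem_empty_iff_false, iff_false]
      rintro ⟨⟨p, rfl⟩, h'⟩
      simp only [size] at h'
      exact h h'.symm
    rw [this]; simp

lemma gf_nil : gf sizeList ({[]} : Set (List (AT n))) = 1 := by
  ext m
  simp only [gf, coeff_mk, coeff_one]
  split_ifs with h
  · subst h
    have : ({[]} : Set (List (AT n))) ∩ {x | sizeList x = 0} = {[]} := by
      rw [Set.inter_eq_left]
      rintro t rfl
      simp [sizeList]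
    rw [this]; simp
  · have : ({[]} : Set (List (AT n))) ∩ {x | sizeList x = m} = ∅ := by
      ext t
      simp only [Set.mem_inter_iff, Set.mem_ofPred_eq, Set.mem_empty_iff_false, iff_false]
      rintro ⟨rfl, h'⟩
      simp only [sizeList] at h'
      exact h h'.symm
    rw [this]; simp

lemma gf_Wf (c : Bool) : gf size (Wf n c) = PowerSeries.C (2 * n : ℝ) * X + gf size (Nd n (!c)) := by
  rw [Wf_eq, gf_union finT (Lf_Nd _), gf_Lf]

lemma gf_Ls_zero (c : Bool) :
    gf sizeList (Ls n c 0) = 1 + gf size (Wf n c) * gf sizeList (Ls n c 0) := by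
  have e : Ls n c 0 = {[]} ∪ Set.image2 List.cons (Wf n c) (Ls n c 0) := by
    ext l
    cases l with
    | nil => simp [Ls]
    | cons t l => simp [Ls]
  have hd : Disjoint ({[]} : Set (List (AT n))) (Set.image2 List.cons (Wf n c) (Ls n c 0)) := by
    simp
  conv_lhs => rw [e]
  rw [gf_union finL hd, gf_nil, gf_image2 finL _ cons_inj2 (sz := size) (sz' := sizeList)]
  intro x y; simp [sizeList]

lemma gf_Ls_succ (c : Bool) (k : ℕ) :
    gf sizeList (Ls n c (k+1)) = PowerSeries.C (2 * n : ℝ) * X * gf sizeList (Ls n c (k+1)) +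
      gf size (Nd n (!c)) * gf sizeList (Ls n c k) := by
  have e : Ls n c (k+1) = Set.image2 List.cons (Lf n) (Ls n c (k+1)) ∪
      Set.image2 List.cons (Nd n (!c)) (Ls n c k) := by
    ext l
    cases l with
    | nil => simp [Ls, nl]
    | cons t l =>
      simp only [Set.mem_union, Set.mem_image2, List.cons.injEq,
        exists_eq_right_right]
      simp only [Ls, Set.mem_ofPred_eq, List.forall_mem_cons]
      constructor
      · rintro ⟨⟨h1, h2⟩, h3⟩
        have h1' := h1
        rw [Wf_eq] at h1'
        rcases h1' with h | h
        · rw [Lf_nl h] at h3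
          exact Or.inl ⟨h, h2, h3⟩
        · rw [Nd_nl h] at h3
          exact Or.inr ⟨h, h2, by omega⟩
      · rintro (⟨h, h2, h3⟩ | ⟨h, h2, h3⟩)
        · rw [Lf_nl h]
          exact ⟨⟨by rw [Wf_eq]; exact Or.inl h, h2⟩, h3⟩
        · rw [Nd_nl h]
          exact ⟨⟨by rw [Wf_eq]; exact Or.inr h, h2⟩, by omega⟩
  have hd : Disjoint (Set.image2 List.cons (Lf n) (Ls n c (k+1)))
      (Set.image2 List.cons (Nd n (!c)) (Ls n c k)) := by
    rw [Set.disjoint_left]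
    rintro l ⟨t, ht, l', _, rfl⟩ ⟨t', ht', l'', _, h⟩
    simp only [List.cons.injEq] at h
    obtain ⟨rfl, rfl⟩ := h
    exact Set.disjoint_left.1 (Lf_Nd _) ht ht'
  conv_lhs => rw [e]
  have hs : ∀ (x : AT n) (y : List (AT n)), sizeList (x :: y) = size x + sizeList y := by
    intro x y; simp [sizeList]
  rw [gf_union finL hd, gf_image2 finL _ cons_inj2 hs, gf_image2 finL _ cons_inj2 hs, gf_Lf]

lemma node_inj (c : Bool) : Function.Injective (AT.node (n := n) c) := by
  intro a b h
  simpa using h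

lemma node_size (c : Bool) (l : List (AT n)) : size (AT.node c l) = sizeList l + 1 := by
  simp [size, add_comm]

lemma Nd_image (c : Bool) : Nd n c = AT.node c '' L2 n c := by
  ext t
  cases t with
  | leaf i b => simp [Nd, rootConn]
  | node c' ts =>
    simp only [Nd, rootConn, Set.mem_ofPred_eq, Set.mem_image, AT.node.injEq, Option.some.injEq, L2, Wf]
    constructor
    · rintro ⟨h, rfl⟩
      cases h with
      | node _ _ h1 h2 h3 => exact ⟨ts, ⟨fun t ht => ⟨h2 t ht, h3 t ht⟩, h1⟩, rfl, rfl⟩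
    · rintro ⟨l, ⟨h1, h2⟩, rfl, rfl⟩
      exact ⟨WF.node _ _ h2 (fun t ht => (h1 t ht).1) (fun t ht => (h1 t ht).2), rfl⟩

lemma gf_Nd (c : Bool) : gf size (Nd n c) = X * gf sizeList (L2 n c) := by
  rw [Nd_image, gf_image (AT.node c) (node_inj c) 1 (node_size c), pow_one]

lemma gf_L2 (c : Bool) :
    gf sizeList (Ls n c 0) = gf sizeList (L2 n c) + (1 + gf size (Wf n c)) := by
  have e : Ls n c 0 = L2 n c ∪ ({[]} ∪ (fun t => [t]) '' Wf n c) := by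
    ext l
    rcases l with _ | ⟨t, _ | ⟨t', l⟩⟩
    · simp [Ls, L2]
    · simp [Ls, L2]
    · simp [Ls, L2]
  have h1 : Disjoint ({[]} : Set (List (AT n))) ((fun t => [t]) '' Wf n c) := by simp
  have h2 : Disjoint (L2 n c) ({[]} ∪ (fun t => [t]) '' Wf n c) := by
    rw [Set.disjoint_left]
    rintro l ⟨_, hl⟩ (rfl | ⟨t, _, rfl⟩) <;> simp at hl
  rw [e, gf_union finL h2, gf_union finL h1, gf_nil,
    gf_image (sz := size) (fun t => [t]) (fun a b h => by simpa using h) 0, pow_zero, one_mul]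
  intro x; simp [sizeList]

/-- GF of H. -/
lemma H_eq (K : ℕ) (hK : 2 ≤ K) :
    {t : AT n | WF t ∧ K ≤ nl (rootChildren t)} =
      AT.node true '' Ls n true K ∪ AT.node false '' Ls n false K := by
  ext t
  cases t with
  | leaf i b =>
    simp [nl, rootChildren]
    omega
  | node c ts =>
    have key : ∀ c, (WF (AT.node c ts) ∧ K ≤ nl ts) ↔ ts ∈ Ls n c K := by
      intro c
      simp only [Ls, Wf, Set.mem_ofPred_eq]
      constructor
      · rintro ⟨h, h'⟩
        cases h with
        | node _ _ h1 h2 h3 => exact ⟨fun t ht => ⟨h2 t ht, h3 t ht⟩, h'⟩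
      · rintro ⟨h1, h2⟩
        refine ⟨WF.node _ _ ?_ (fun t ht => (h1 t ht).1) (fun t ht => (h1 t ht).2), h2⟩
        refine (hK.trans h2).trans ?_
        exact List.length_filter_le _ _
    simp only [rootChildren, Set.mem_ofPred_eq, key, Set.mem_union, Set.mem_image, AT.node.injEq]
    cases c <;> simp

lemma gf_H (K : ℕ) (hK : 2 ≤ K) :
    gf size {t : AT n | WF t ∧ K ≤ nl (rootChildren t)} =
      X * gf sizeList (Ls n true K) + X * gf sizeList (Ls n false K) := by
  rw [H_eq K hK, gf_union finT, gf_image (AT.node true) (node_inj _) 1 (node_size _),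
    gf_image (AT.node false) (node_inj _) 1 (node_size _), pow_one]
  rw [Set.disjoint_left]
  rintro t ⟨l, _, rfl⟩ ⟨l', _, h⟩
  simp at h

lemma gf_all : gf size {t : AT n | WF t} = PowerSeries.C (2 * n : ℝ) * X +
    (gf size (Nd n true) + gf size (Nd n false)) := by
  rw [all_eq, gf_union finT, gf_union finT Nd_Nd, gf_Lf]
  rw [Set.disjoint_union_right]
  exact ⟨Lf_Nd _, Lf_Nd _⟩

lemma gf_const_zero (S : Set (AT n)) : constantCoeff (gf size S) = 0 := by
  rw [← coeff_zero_eq_constantCoeff_apply]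
  simp only [gf, coeff_mk]
  have : S ∩ {x | size x = 0} = ∅ := by
    ext t
    have := size_pos' t
    simp only [Set.mem_inter_iff, Set.mem_ofPred_eq, Set.mem_empty_iff_false, iff_false]
    omega
  rw [this]; simp

lemma Nd_symm : gf size (Nd n true) = gf size (Nd n false) := by
  have a1 := gf_Nd (n := n) true
  have a2 := gf_Nd (n := n) false
  have b1 := gf_L2 (n := n) true
  have b2 := gf_L2 (n := n) false
  have c1 := gf_Ls_zero (n := n) true
  have c2 := gf_Ls_zero (n := n) false
  have d1 := gf_Wf (n := n) true
  have d2 := gf_Wf (n := n) false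
  simp only [Bool.not_true, Bool.not_false] at d1 d2
  set Pt := gf size (Nd n true)
  set Pf := gf size (Nd n false)
  set lt := gf sizeList (Ls n true 0)
  set lf := gf sizeList (Ls n false 0)
  set Bt := gf size (Wf n true)
  set Bf := gf size (Wf n false)
  set Qt := gf sizeList (L2 n true)
  set Qf := gf sizeList (L2 n false)
  have e1 : (Pt - Pf) * (1 + X * (lt * lf - 1)) = 0 := by
    have h1 : Bt - Bf = Pf - Pt := by rw [d1, d2]; ring
    have h2 : lt - lf = lt * lf * (Bt - Bf) := by
      linear_combination lf * c1 - lt * c2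
    have h3 : Pt - Pf = X * ((lt - lf) - (Bt - Bf)) := by
      rw [a1, a2, b1, b2]; ring
    rw [h2, h1] at h3
    linear_combination h3
  rcases mul_eq_zero.1 e1 with h | h
  · exact sub_eq_zero.1 h
  · exfalso
    have := congrArg (constantCoeff (R := ℝ)) h
    simp at this

/-- Summary of the combinatorial part. -/
lemma comb_main (n K : ℕ) (hK : 2 ≤ K) : ∃ P l : PowerSeries ℝ, ∃ g : ℕ → PowerSeries ℝ,
    constantCoeff P = 0 ∧
    l * (1 - (C (2 * n : ℝ) * X + P)) = 1 ∧ P = X * (l - 1 - (C (2 * n : ℝ) * X + P)) ∧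
    g 0 = l ∧ (∀ k, g (k+1) * (1 - C (2 * n : ℝ) * X) = P * g k) ∧
    gf size {t : AT n | WF t} = C (2 * n : ℝ) * X + 2 * P ∧
    gf size {t : AT n | WF t ∧ K ≤ nl (rootChildren t)} = 2 * X * g K := by
  have hW : ∀ c, gf size (Wf n c) = C (2 * n : ℝ) * X + gf size (Nd n true) := by
    intro c
    rw [gf_Wf]
    cases c
    · rfl
    · rw [Nd_symm]; rfl
  have hN : ∀ c, gf size (Nd n c) = gf size (Nd n true) := by
    intro c
    cases c
    · rw [Nd_symm]
    · rfl
  set P := gf size (Nd n true) with hP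
  have h0 : ∀ c, gf sizeList (Ls n c 0) * (1 - (C (2 * n : ℝ) * X + P)) = 1 := by
    intro c
    have := gf_Ls_zero (n := n) c
    rw [hW] at this
    linear_combination this
  have hS : ∀ c k, gf sizeList (Ls n c (k+1)) * (1 - C (2 * n : ℝ) * X)
      = P * gf sizeList (Ls n c k) := by
    intro c k
    have := gf_Ls_succ (n := n) c k
    rw [hN] at this
    linear_combination this
  have hne : (1 - C (2 * n : ℝ) * X : PowerSeries ℝ) ≠ 0 := by
    intro h
    have := congrArg (constantCoeff (R := ℝ)) h
    simp at this
  have hne' : (1 - (C (2 * n : ℝ) * X + P) : PowerSeries ℝ) ≠ 0 := by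
    intro h
    have := h0 true
    rw [h, mul_zero] at this
    exact zero_ne_one this
  have hsym : ∀ k, gf sizeList (Ls n false k) = gf sizeList (Ls n true k) := by
    intro k
    induction k with
    | zero => exact mul_right_cancel₀ hne' ((h0 _).trans (h0 _).symm)
    | succ k ih =>
      apply mul_right_cancel₀ hne
      rw [hS, hS, ih]
  refine ⟨P, gf sizeList (Ls n true 0), fun k => gf sizeList (Ls n true k), gf_const_zero _,
    h0 true, ?_, rfl, hS true, ?_, ?_⟩
  · have h1 := gf_Nd (n := n) true
    have h2 := gf_L2 (n := n) true
    rw [hW] at h2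
    rw [h2]
    rw [← hP] at h1
    linear_combination h1
  · rw [gf_all, hN false]; ring
  · rw [gf_H K hK, hsym]; ring

lemma coeff_all (n m : ℕ) : coeff m (gf size {t : AT n | WF t}) = (A n m : ℝ) := by
  simp only [gf, coeff_mk, A, countIn, Set.mem_univ, true_and]
  rfl

lemma coeff_H (n m K : ℕ) (hK : K = ⌊(n : ℝ) ^ ((1 : ℝ) / 8)⌋₊ + 1) :
    coeff m (gf size {t : AT n | WF t ∧ K ≤ nl (rootChildren t)}) = (countIn n (Hfam n) m : ℝ) := by
  simp only [gf, coeff_mk, countIn]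
  have : {t : AT n | WF t ∧ K ≤ nl (rootChildren t)} ∩ {t | size t = m} =
      {t | t ∈ Hfam n ∧ WF t ∧ size t = m} := by
    ext t
    simp only [Set.mem_inter_iff, Set.mem_ofPred_eq, Hfam]
    rw [← Nat.floor_lt (by positivity), hK, Nat.succ_le_iff, nl]
    tauto
  rw [this]
  rfl

end comb

section final
open PowerSeries Filter Topology

/-- The explicit value of the limiting ratio, with `s = √(2n)`. -/
noncomputable def muVal (s : ℝ) (K : ℕ) : ℝ :=
  (s / (2 * (s + 1))) ^ K * ((s + 1) ^ 2 / (s * (s + 2))) * (K + 1 + 2 * K / s)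

lemma asym_main (n K : ℕ) (hn : 1 ≤ n) (hK : 2 ≤ K) (s : ℝ) (hs0 : 1 < s) (hs : s ^ 2 = 2 * n) :
    Tendsto (fun m => coeff m (gf size {t : AT n | WF t ∧ K ≤ nl (rootChildren t)}) /
      coeff m (gf size {t : AT n | WF t})) atTop (𝓝 (muVal s K)) := by
  obtain ⟨P, l, g, hP0, hl, hP, hg0, hg, hT, hH⟩ := comb_main n K hK
  rw [hT, hH]
  rw [← hs] at *
  set L : PowerSeries ℝ := C (s ^ 2) * X with hL
  set a : ℝ := s * (s + 2) with ha
  set b : ℝ := s * (s - 2) with hb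
  have ha0 : 0 < a := by positivity
  set ρ : ℝ := 1 / a with hρdef
  have hρ : 0 < ρ := by positivity
  set u : ℕ → ℝ := fun m => (catalan m : ℝ) * (a / 4) ^ m with hu
  have upos : ∀ m, 0 < u m := by
    intro m
    have : (0:ℝ) < catalan m := by exact_mod_cast catalan_pos' m
    positivity
  have hr : Tendsto (fun m => u m / u (m + 1)) atTop (𝓝 ρ) := catalan_ratio_tendsto ha0
  have hC2 : (C (2:ℝ) : PowerSeries ℝ) = 2 := map_ofNat (PowerSeries.C (R := ℝ)) 2
  -- the quadratic equation
  have hquad : (1 + X) * (L + P) ^ 2 - (1 + L) * (L + P) + L = 0 := by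
    linear_combination (-(1 - (L + P))) * hP - X * hl
  have hdisc : (2 * (1 + X) * (L + P) - (1 + L)) ^ 2 = (sqS b * sqS a) ^ 2 := by
    rw [mul_pow, sqS_sq, sqS_sq]
    have e1 : (C a : PowerSeries ℝ) = C s * (C s + 2) := by
      rw [ha, map_mul, map_add, hC2]
    have e2 : (C b : PowerSeries ℝ) = C s * (C s - 2) := by
      rw [hb, map_mul, map_sub, hC2]
    have e3 : L = C s ^ 2 * X := by rw [hL, map_pow]
    rw [e1, e2]
    rw [e3] at hquad ⊢
    linear_combination (4 * (1 + X)) * hquad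
  have hB : 2 * (1 + X) * (L + P) = (1 + L) - sqS b * sqS a := by
    rcases sq_eq_sq_iff_eq_or_eq_neg.1 hdisc with h | h
    · exfalso
      have := congrArg (constantCoeff (R := ℝ)) h
      simp [sqS, hP0, hL] at this
      norm_num at this
    · linear_combination h
  -- good series
  have gL : Good ρ L (s ^ 2 * ρ) := (Good.C _).mul hρ Good.X
  have hs2a : |s ^ 2| * ρ < 1 := by
    rw [abs_of_pos (by positivity), hρdef, mul_one_div, div_lt_one ha0, ha]; nlinarith
  have h1a : |(-1 : ℝ)| * ρ < 1 := by
    rw [abs_neg, abs_one, one_mul, hρdef, div_lt_one ha0, ha]; nlinarith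
  have hba : |b| * ρ < 1 := by
    rw [hρdef, mul_one_div, div_lt_one ha0, abs_lt, ha, hb]
    constructor <;> nlinarith
  have gG := Good.geo (c := s ^ 2) hρ hs2a
  have gE := Good.geo (c := -1) hρ h1a
  obtain ⟨σ, hσ0, gS⟩ := Good.sqS (c := b) hρ hba
  have hG := geo_mul (s ^ 2)
  rw [← hL] at hG
  have hE : geo (-1) * (1 + X) = 1 := by
    have := geo_mul (-1)
    simpa using this
  set G := geo (s ^ 2)
  set E := geo (-1)
  have gX : Good ρ X ρ := Good.X
  have g1 : Good ρ 1 1 := Good.one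
  -- asymptotics of B
  have aC : Asy u (catS a) 1 := by
    refine tendsto_const_nhds.congr fun m => ?_
    simp only [catS, coeff_mk]
    exact (div_self (upos m).ne').symm
  have aSq : Asy u (sqS a) (0 - a / 2 * (ρ * 1)) :=
    (g1.zero_asy hρ upos hr).sub
      (Asy.mul_good hρ upos hr (Good.C (a / 2)) (Asy.mul_good hρ upos hr gX aC))
  have e4 : 0 - a / 2 * (ρ * 1) = -(1/2) := by
    rw [hρdef]; field_simp; ring
  rw [e4] at aSq
  have aS := Asy.mul_good hρ upos hr gS aSq
  have a1L := (g1.add hρ gL).zero_asy hρ upos hr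
  have aRHS := a1L.sub aS
  have hBe : L + P = C (1/2) * E * ((1 + L) - sqS b * sqS a) := by
    rw [← hB]
    have e5 : (C (1/2) : PowerSeries ℝ) * 2 = 1 := by
      rw [← map_ofNat (PowerSeries.C (R := ℝ)) 2, ← map_mul]; norm_num
    calc L + P = (C (1/2) * 2) * (E * (1 + X)) * (L + P) := by rw [hE, e5]; ring
      _ = _ := by ring
  have aB := Asy.mul_good hρ upos hr ((Good.C (1/2)).mul hρ gE) aRHS
  rw [← hBe] at aB
  set κ := 1 / 2 * (1 - -1 * ρ)⁻¹ * (0 - σ * -(1 / 2)) with hκ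
  have hκ0 : κ ≠ 0 := by
    have : (1 - -1 * ρ) ≠ 0 := by
      have : 0 < 1 - -1 * ρ := by linarith
      exact this.ne'
    rw [hκ]
    refine mul_ne_zero (mul_ne_zero (by norm_num) (inv_ne_zero this)) ?_
    rw [zero_sub, ← mul_neg, neg_neg]
    exact mul_ne_zero hσ0 (by norm_num)
  have aP : Asy u P κ := by
    have := aB.sub (gL.zero_asy hρ upos hr)
    simpa using this
  -- the series r
  set r := G * P with hrdef
  have aR := Asy.mul_good hρ upos hr gG aP
  rw [← hrdef] at aR
  have hPr : P = (1 - L) * r := by rw [hrdef]; linear_combination (-P) * hG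
  have hrq : (1 + X) * (1 - L) ^ 2 * r ^ 2 = (1 - L) * ((1 - L) - 2 * X * L) * r - X * L ^ 2 := by
    rw [hPr] at hquad
    linear_combination hquad
  have hr2 : r ^ 2 = (E * G * ((1 - L) - 2 * X * L)) * r - (E * G ^ 2 * X * L ^ 2) := by
    calc r ^ 2 = (E * (1 + X)) * (G * (1 - L)) ^ 2 * r ^ 2 := by rw [hE, hG]; ring
      _ = E * G ^ 2 * ((1 + X) * (1 - L) ^ 2 * r ^ 2) := by ring
      _ = E * G * (G * (1 - L)) * ((1 - L) - 2 * X * L) * r - (E * G ^ 2 * X * L ^ 2) := by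
        rw [hrq]; ring
      _ = _ := by rw [hG]; ring
  set r0 : ℝ := s / (2 * (s + 1)) with hr0
  have hs1 : s ≠ 0 := by positivity
  have hs2 : s + 1 ≠ 0 := by positivity
  have hs3 : s + 2 ≠ 0 := by positivity
  have v1 : (1 - -1 * ρ)⁻¹ = s * (s + 2) / (s + 1) ^ 2 := by
    rw [hρdef, ha, inv_eq_iff_eq_inv, inv_div]; field_simp; ring
  have v2 : (1 - s ^ 2 * ρ)⁻¹ = (s + 2) / 2 := by
    rw [hρdef, ha, inv_eq_iff_eq_inv, inv_div]; field_simp; ring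
  have g2 : Good ρ (2 : PowerSeries ℝ) 2 := by
    have := Good.C (ρ := ρ) 2
    rwa [hC2] at this
  have gα : Good ρ (E * G * ((1 - L) - 2 * X * L)) (2 * r0) := by
    convert (gE.mul hρ gG).mul hρ ((g1.sub hρ gL).sub hρ ((g2.mul hρ gX).mul hρ gL)) using 1
    rw [v1, v2, hρdef, ha, hr0]
    field_simp
    ring
  have gβ : Good ρ (E * G ^ 2 * X * L ^ 2) (r0 ^ 2) := by
    rw [pow_two G, pow_two L]
    convert ((gE.mul hρ (gG.mul hρ gG)).mul hρ gX).mul hρ (gL.mul hρ gL) using 1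
    rw [v1, v2, hρdef, ha, hr0]
    field_simp
  set c1 := (1 - s ^ 2 * ρ)⁻¹ * κ with hc1
  have hr00 : r0 ≠ 0 := by positivity
  have apow : ∀ k : ℕ, Asy u (r ^ k) (k * (r0 ^ k / r0) * c1) ∧
      Asy u (r ^ (k + 1)) ((k + 1 : ℕ) * (r0 ^ (k + 1) / r0) * c1) := by
    intro k
    induction k with
    | zero =>
      constructor
      · simpa using g1.zero_asy hρ upos hr
      · simpa [hr00] using aR
    | succ k ih =>
      refine ⟨ih.2, ?_⟩
      have h1 := (Asy.mul_good hρ upos hr gα ih.2).sub (Asy.mul_good hρ upos hr gβ ih.1)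
      convert h1 using 1
      · rw [pow_succ r (k+1), pow_succ r k]
        linear_combination (r ^ k) * hr2
      · push_cast
        rw [pow_succ r0 (k+1), pow_succ r0 k]
        field_simp
        ring
  -- H
  have hgk : ∀ k, g k = r ^ k * l := by
    intro k
    induction k with
    | zero => simp [hg0]
    | succ k ih =>
      calc g (k+1) = G * (g (k+1) * (1 - L)) := by linear_combination (-g (k+1)) * hG
        _ = _ := by rw [hg, ih, hrdef]; ring
  have hHr : 2 * X * g K = 2 * (1 + X) * (1 - L) * r ^ (K + 1) + 2 * X * (1 + L) * r ^ K := by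
    rw [hgk]
    have h1 : X * l = P + X + X * (L + P) := by linear_combination -hP
    have h2 : P + X + X * (L + P) = (1 + X) * (1 - L) * r + X * (1 + L) := by
      linear_combination (1 + X) * hPr
    linear_combination 2 * r ^ K * (h1.trans h2)
  have aH := (Asy.mul_good hρ upos hr (((g2.mul hρ (g1.add hρ gX)).mul hρ (g1.sub hρ gL)))
      (apow K).2).add (Asy.mul_good hρ upos hr ((g2.mul hρ gX).mul hρ (g1.add hρ gL)) (apow K).1)
  rw [← hHr] at aH
  have aT : Asy u (L + 2 * P) (0 + 2 * κ) :=
    (gL.zero_asy hρ upos hr).add (Asy.mul_good hρ upos hr g2 aP)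
  have fin := Filter.Tendsto.div aH aT (by rw [zero_add]; exact mul_ne_zero two_ne_zero hκ0)
  have hval : (2 * (1 + ρ) * (1 - s ^ 2 * ρ) * ((K + 1 : ℕ) * (r0 ^ (K + 1) / r0) * c1) +
      2 * ρ * (1 + s ^ 2 * ρ) * (K * (r0 ^ K / r0) * c1)) / (0 + 2 * κ) = muVal s K := by
    rw [hc1, v2, muVal, ← hr0, pow_succ r0 K, mul_div_assoc, div_self hr00]
    have : r0 ^ K / r0 = r0 ^ K * (2 * (s + 1) / s) := by
      rw [div_eq_mul_inv, hr0, inv_div]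
    rw [this, hρdef, ha]
    generalize r0 ^ K = q
    push_cast
    field_simp
    ring
  rw [hval] at fin
  refine fin.congr fun m => ?_
  simp only [Pi.div_apply]
  rw [div_div_div_cancel_right₀ (upos m).ne']

lemma noWF (t : AT 0) : ¬ WF t := by
  intro h
  induction h with
  | leaf i b => exact i.elim0
  | node c ts h1 h2 h3 ih =>
    cases ts with
    | nil => simp at h1
    | cons t ts => exact ih t (by simp)

end final

/-- The limiting ratio of `ℋ_n` is `Θ(n^{1/8}·2^{−n^{1/8}})` as `n → ∞`. -/
theorem statement11 :
    ∃ μ : ℕ → ℝ, (∀ n : ℕ, HasLimRatio n (Hfam n) (μ n)) ∧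
      ∃ c₁ c₂ : ℝ, 0 < c₁ ∧ c₁ ≤ c₂ ∧ ∃ N : ℕ, ∀ n : ℕ, N ≤ n →
        c₁ * (n : ℝ) ^ ((1 : ℝ) / 8) * (2 : ℝ) ^ (-((n : ℝ) ^ ((1 : ℝ) / 8))) ≤ μ n ∧
        μ n ≤ c₂ * (n : ℝ) ^ ((1 : ℝ) / 8) * (2 : ℝ) ^ (-((n : ℝ) ^ ((1 : ℝ) / 8))) := by
  refine ⟨fun n => if n = 0 then 0 else
    muVal (Real.sqrt (2 * n)) (⌊(n : ℝ) ^ ((1 : ℝ) / 8)⌋₊ + 1), ?_, 1/4, 14, by norm_num,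
    by norm_num, 256, ?_⟩
  · intro n
    rcases Nat.eq_zero_or_pos n with rfl | hn
    · simp only [if_true]
      refine tendsto_const_nhds.congr fun m => ?_
      have : A 0 m = 0 := by
        rw [A, countIn, Nat.card_eq_zero]
        left
        exact ⟨fun t => noWF t.1 t.2.2.1⟩
      rw [ratio, this]; simp
    · simp only [hn.ne', if_false]
      have hn1 : (1:ℝ) ≤ n := by exact_mod_cast hn
      have hf : 1 ≤ ⌊(n : ℝ) ^ ((1 : ℝ) / 8)⌋₊ := by
        rw [Nat.one_le_floor_iff]
        exact Real.one_le_rpow hn1 (by norm_num)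
      have h := asym_main n (⌊(n : ℝ) ^ ((1 : ℝ) / 8)⌋₊ + 1) hn (by omega) (Real.sqrt (2 * n))
        (by rw [Real.lt_sqrt (by norm_num)]; linarith) (Real.sq_sqrt (by positivity))
      refine h.congr fun m => ?_
      rw [coeff_H n m _ rfl, coeff_all, ratio]
  · intro n hn
    have hn0 : n ≠ 0 := by omega
    simp only [hn0, if_false]
    have hn' : (256:ℝ) ≤ n := by exact_mod_cast hn
    set t : ℝ := (n : ℝ) ^ ((1 : ℝ) / 8) with ht
    have ht8 : t ^ 8 = n := by
      rw [ht, ← Real.rpow_natCast, ← Real.rpow_mul (by positivity)]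
      norm_num
    have ht0 : 0 < t := Real.rpow_pos_of_pos (by linarith) _
    have ht2 : 2 ≤ t := by
      by_contra h
      push Not at h
      have : t ^ 8 < 2 ^ 8 := pow_lt_pow_left₀ h ht0.le (by norm_num)
      rw [ht8] at this
      linarith
    set s : ℝ := Real.sqrt (2 * n) with hs
    have hst : t ^ 4 ≤ s := by
      rw [hs]
      apply Real.le_sqrt_of_sq_le
      rw [← pow_mul, ht8]; linarith
    have ht4 : 8 * t ≤ t ^ 4 := by
      have : 8 ≤ t ^ 3 := by
        calc (8:ℝ) = 2 ^ 3 := by norm_num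
          _ ≤ t ^ 3 := pow_le_pow_left₀ (by norm_num) ht2 3
      nlinarith
    have hs8 : 8 * t ≤ s := ht4.trans hst
    have hs0 : 0 < s := by linarith
    set K : ℕ := ⌊t⌋₊ + 1 with hK
    have hKl : t < K := by rw [hK]; push_cast; exact Nat.lt_floor_add_one t
    have hKu : (K : ℝ) ≤ t + 1 := by
      rw [hK]; push_cast
      linarith [Nat.floor_le ht0.le]
    have p2 : (0:ℝ) < (2:ℝ) ^ (-t) := Real.rpow_pos_of_pos (by norm_num) _
    have q1 : ((1:ℝ)/2) ^ K ≤ 2 ^ (-t) := by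
      rw [one_div, inv_pow, ← Real.rpow_natCast, ← Real.rpow_neg (by norm_num)]
      exact Real.rpow_le_rpow_of_exponent_le (by norm_num) (by linarith)
    have q2 : (1/2) * (2:ℝ) ^ (-t) ≤ ((1:ℝ)/2) ^ K := by
      have e : (1/2) * (2:ℝ) ^ (-t) = 2 ^ (-(t + 1)) := by
        rw [neg_add, Real.rpow_add (by norm_num), Real.rpow_neg_one]; ring
      rw [e, one_div, inv_pow, ← Real.rpow_natCast, ← Real.rpow_neg (by norm_num)]
      exact Real.rpow_le_rpow_of_exponent_le (by norm_num) (by linarith)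
    have er : s / (2 * (s + 1)) = (1/2) * (1 + -(1 / (s + 1))) := by field_simp; ring
    have hinv : 1 / (s + 1) ≤ 1 := by rw [div_le_one (by linarith)]; linarith
    have hinv0 : 0 < 1 / (s + 1) := by positivity
    have r1 : (s / (2 * (s + 1))) ^ K ≤ ((1:ℝ)/2) ^ K := by
      rw [er, mul_pow]
      refine mul_le_of_le_one_right (by positivity) (pow_le_one₀ (by linarith) (by linarith))
    have r2 : (1/2) * ((1:ℝ)/2) ^ K ≤ (s / (2 * (s + 1))) ^ K := by
      rw [er, mul_pow, mul_comm]
      refine mul_le_mul_of_nonneg_left ?_ (by positivity)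
      have hb := one_add_mul_le_pow (a := -(1 / (s + 1))) (by linarith) K
      refine le_trans ?_ hb
      have : (K : ℝ) * (1 / (s + 1)) ≤ 1/2 := by
        rw [mul_one_div, div_le_iff₀ (by linarith)]; linarith
      linarith
    have f1 : 1 ≤ (s + 1) ^ 2 / (s * (s + 2)) := by
      rw [le_div_iff₀ (by positivity)]; nlinarith
    have f2 : (s + 1) ^ 2 / (s * (s + 2)) ≤ 2 := by
      rw [div_le_iff₀ (by positivity)]; nlinarith
    have k0 : 0 ≤ 2 * (K : ℝ) / s := by positivity
    have k1 : 2 * (K : ℝ) / s ≤ K := by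
      rw [div_le_iff₀ hs0]
      nlinarith
    have rp : 0 < (s / (2 * (s + 1))) ^ K := by positivity
    rw [muVal]
    set R := (s / (2 * (s + 1))) ^ K
    set F := (s + 1) ^ 2 / (s * (s + 2))
    set M := (K : ℝ) + 1 + 2 * K / s
    constructor
    · calc 1/4 * t * (2:ℝ) ^ (-t) = ((1/2) * ((1/2) * (2:ℝ) ^ (-t))) * 1 * t := by ring
        _ ≤ R * F * M := by
          have : (1/2) * ((1/2) * (2:ℝ) ^ (-t)) ≤ R := by linarith
          have : t ≤ M := by simp only [M]; linarith
          gcongr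
    · calc R * F * M ≤ (2:ℝ) ^ (-t) * 2 * (7 * t) := by
            have : R ≤ (2:ℝ) ^ (-t) := by linarith
            have : M ≤ 7 * t := by simp only [M]; linarith
            have : 0 ≤ M := by simp only [M]; linarith
            gcongr
        _ = 14 * t * (2:ℝ) ^ (-t) := by ring
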